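/- arXiv:2409.14264 — 2 statements merged into one kernel-verified Lean document; each statement's English description precedes it below -/
import Mathlib

section
/- Let q be an odd prime power with q ≡ 3 (mod 4), η the quadratic character of F_q, and u ∈ F_q with u ∉ {0, 1, -1}. Define F_{2,u}(x) = x^2(1 + u·η(x)). Then δ_{F_{2,u}}(1, u+1) ≤ 4 and δ_{F_{2,u}}(1, u-1) ≤ 4, where δ_F(1,b) = #{x ∈ F_q : F(x+1) - F(x) = b}. -/
/-- The roots of `u * x ^ 2 - (1 - u) * x + u` come in a pair `r, r⁻¹`. -/
lemma exists_root_pair {F : Type*} [Field F] {u : F} (hu : u ≠ 0) :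
    ∃ r : F, ∀ x : F, u * x ^ 2 - (1 - u) * x + u = 0 → x = r ∨ x = r⁻¹ := by
  by_cases h : ∃ r : F, u * r ^ 2 - (1 - u) * r + u = 0
  · obtain ⟨r, hr⟩ := h
    have hr0 : r ≠ 0 := by
      rintro rfl
      exact hu (by simpa using hr)
    refine ⟨r, fun x hx => ?_⟩
    have key : (u * (x - r)) * (x * r - 1) = 0 := by
      linear_combination r * hx - x * hr
    rcases mul_eq_zero.1 key with h | h
    · exact Or.inl (sub_eq_zero.1 ((mul_eq_zero.1 h).resolve_left hu))
    · exact Or.inr (eq_inv_of_mul_eq_one_left (sub_eq_zero.1 h))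
  · exact ⟨0, fun x hx => (h ⟨x, hx⟩).elim⟩

lemma ncard_derivative_eq_add_one_le {F : Type*} [Field F] [Fintype F] [DecidableEq F]
    (hF : ringChar F ≠ 2) (hη : quadraticChar F (-1) = -1)
    (u : F) (h0 : u ≠ 0) (h1 : u ≠ 1) (h1' : u ≠ -1) :
    {x : F | (x + 1) ^ 2 * (1 + u * ((quadraticChar F (x + 1) : ℤ) : F))
        - x ^ 2 * (1 + u * ((quadraticChar F x : ℤ) : F)) = u + 1}.ncard ≤ 4 := by
  have h2 : (2 : F) ≠ 0 := Ring.two_ne_zero hF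
  have hsub : 1 - u ≠ 0 := sub_ne_zero.2 h1.symm
  have hadd : 1 + u ≠ 0 := fun h => h1' (by linear_combination h)
  obtain ⟨r, hr⟩ := exists_root_pair h0
  let a : F := if quadraticChar F u = 1 then u / (1 - u) else -(1 + u) / u
  suffices hS : {x : F | (x + 1) ^ 2 * (1 + u * ((quadraticChar F (x + 1) : ℤ) : F))
      - x ^ 2 * (1 + u * ((quadraticChar F x : ℤ) : F)) = u + 1} ⊆
      (({0, a, r, r⁻¹} : Finset F) : Set F) by
    refine (Set.ncard_le_ncard hS (Finset.finite_toSet _)).trans ?_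
    rw [Set.ncard_coe_finset]
    exact Finset.card_le_four
  intro x hx
  simp only [Set.mem_ofPred_eq] at hx
  simp only [Finset.coe_insert, Finset.coe_singleton, Set.mem_insert_iff,
    Set.mem_singleton_iff]
  by_cases hx0 : x = 0
  · exact Or.inl hx0
  by_cases hx1 : x + 1 = 0
  · obtain rfl : x = -1 := eq_neg_of_add_eq_zero_left hx1
    rw [hη] at hx
    push_cast at hx
    refine (h2 ?_).elim
    linear_combination -hx
  right
  rcases quadraticChar_dichotomy hx1 with hs | hs <;>
    rcases quadraticChar_dichotomy hx0 with ht | ht <;>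
    rw [hs, ht] at hx <;> push_cast at hx
  · refine (mul_ne_zero (mul_ne_zero h2 hadd) hx0 ?_).elim
    linear_combination hx
  · left
    have e : u * x = -(1 + u) := by
      refine mul_left_cancel₀ (mul_ne_zero h2 hx0) ?_
      linear_combination hx
    have e' : u * (x + 1) = -1 := by linear_combination e
    have hu : quadraticChar F u = -1 := by
      have := congrArg (quadraticChar F) e'
      rwa [map_mul, hs, hη, mul_one] at this
    simp only [a, hu]
    rw [if_neg (by decide), eq_div_iff h0]
    linear_combination e
  · right
    refine hr x (mul_left_cancel₀ h2 ?_)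
    linear_combination -hx
  · left
    have e : x * (1 - u) = u := by
      refine mul_left_cancel₀ h2 ?_
      linear_combination hx
    have e' : u * (x + 1) = x := by linear_combination -e
    have hu : quadraticChar F u = 1 := by
      have := congrArg (quadraticChar F) e'
      rw [map_mul, hs, ht] at this
      linarith
    simp only [a, hu]
    rw [if_pos trivial, eq_div_iff hsub]
    exact e

/-- Lemma 18 of the paper: for `u ∉ {0, ±1}`,
`δ_{F_{2,u}}(1, u ± 1) ≤ 4`. -/
theorem stmt_10 {F : Type*} [Field F] [Fintype F] [DecidableEq F]
    (hodd : Odd (Fintype.card F)) (h4 : Fintype.card F % 4 = 3)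
    (u : F) (hu : u ∉ ({0, 1, -1} : Set F)) :
    {x : F | (x + 1) ^ 2 * (1 + u * ((quadraticChar F (x + 1) : ℤ) : F))
        - x ^ 2 * (1 + u * ((quadraticChar F x : ℤ) : F)) = u + 1}.ncard ≤ 4 ∧
    {x : F | (x + 1) ^ 2 * (1 + u * ((quadraticChar F (x + 1) : ℤ) : F))
        - x ^ 2 * (1 + u * ((quadraticChar F x : ℤ) : F)) = u - 1}.ncard ≤ 4 := by
  have hF : ringChar F ≠ 2 := fun h => by
    have := FiniteField.even_card_of_char_two h
    omega
  have hη : quadraticChar F (-1) = -1 := by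
    rw [quadraticChar_neg_one hF, ZMod.χ₄_nat_three_mod_four h4]
  have hneg (y : F) : quadraticChar F (-y) = -quadraticChar F y := by
    rw [← neg_one_mul, map_mul, hη, neg_one_mul]
  simp only [Set.mem_insert_iff, Set.mem_singleton_iff, not_or] at hu
  obtain ⟨h0, h1, h1'⟩ := hu
  refine ⟨ncard_derivative_eq_add_one_le hF hη u h0 h1 h1', ?_⟩
  refine le_trans ?_ (ncard_derivative_eq_add_one_le hF hη (-u) (neg_ne_zero.2 h0)
    (fun h => h1' (by rw [← h, neg_neg])) (fun h => h1 (neg_injective h)))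
  -- the reflection `x ↦ -1 - x` exchanges the parameters `u` and `-u`
  refine Set.ncard_le_ncard_of_injOn (fun x => -1 - x) (fun x hx => ?_)
    (fun x _ y _ h => sub_right_injective h) (Set.toFinite _)
  simp only [Set.mem_ofPred_eq] at hx ⊢
  rw [show (-1 - x + 1 : F) = -x by ring, show (-1 - x : F) = -(x + 1) by ring, hneg, hneg]
  push_cast
  linear_combination -hx
end

section
/- Let q be a power of a prime p ≠ 3 with q odd and q ≡ 3 (mod 4), and let η be the quadratic character of F_q. Define F(x) = x^2(1 + (1/3)·η(x)). Then the differential uniformity of F is at most 4. -/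
/-- A set in which any two distinct elements have the same sum has at most two elements. -/
theorem Set.ncard_le_two_of_add_eq {F : Type*} [AddCommGroup F] {T : Set F} (c : F)
    (h : ∀ x ∈ T, ∀ y ∈ T, x ≠ y → x + y = c) : T.ncard ≤ 2 := by
  rcases T.eq_empty_or_nonempty with rfl | ⟨x, hx⟩
  · simp
  · have hsub : T ⊆ {x, c - x} := by
      intro y hy
      by_cases hxy : x = y
      · simp [hxy]
      · right
        rw [Set.mem_singleton_iff, ← h x hx y hy hxy]
        abel
    exact (Set.ncard_le_ncard hsub).trans ((Set.ncard_insert_le _ _).trans (by simp))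

/-- If `-1` is not a square, then a square whose negative is a square vanishes. -/
theorem IsSquare.eq_zero_of_isSquare_neg {F : Type*} [Field F] (hneg : ¬ IsSquare (-1 : F))
    {u : F} (hu : IsSquare u) (hu' : IsSquare (-u)) : u = 0 := by
  by_contra h0
  apply hneg
  have h : (-1 : F) = -u / u := by field_simp
  rw [h]
  exact hu'.div hu

/-- The product of two nonsquares of a finite field is a square. -/
theorem FiniteField.isSquare_mul_of_not_isSquare {F : Type*} [Field F] [Fintype F]
    [DecidableEq F] {u v : F} (hu : ¬ IsSquare u) (hv : ¬ IsSquare v) : IsSquare (u * v) := by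
  have h : quadraticChar F (u * v) = 1 := by
    rw [map_mul, quadraticChar_neg_one_iff_not_isSquare.2 hu,
      quadraticChar_neg_one_iff_not_isSquare.2 hv]
    norm_num
  by_contra huv
  rw [quadraticChar_neg_one_iff_not_isSquare.2 huv] at h
  norm_num at h

theorem mul_one_add_quadraticChar_of_isSquare {F : Type*} [Field F] [Fintype F] [DecidableEq F]
    {x : F} (hx : IsSquare x) (k : F) :
    x ^ 2 * (1 + k * ((quadraticChar F x : ℤ) : F)) = x ^ 2 * (1 + k) := by
  by_cases h0 : x = 0
  · simp [h0]
  · rw [(quadraticChar_one_iff_isSquare h0).2 hx]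
    simp

theorem mul_one_add_quadraticChar_of_not_isSquare {F : Type*} [Field F] [Fintype F]
    [DecidableEq F] {x : F} (hx : ¬ IsSquare x) (k : F) :
    x ^ 2 * (1 + k * ((quadraticChar F x : ℤ) : F)) = x ^ 2 * (1 - k) := by
  rw [quadraticChar_neg_one_iff_not_isSquare.2 hx]
  push_cast
  ring

/-- The solutions of `G (x + a) - G x = c`, where `G x` is `2 * x ^ 2` on squares and `x ^ 2` on
nonsquares, number at most four. -/
theorem ncard_piecewise_sq_derivative_le_four {F : Type*} [Field F] [Fintype F]
    [DecidableEq F] (hneg : ¬ IsSquare (-1 : F)) {a : F} (ha : a ≠ 0) (c : F) :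
    ({x : F | IsSquare (x + a) ∧ IsSquare x ∧ 2 * (x + a) ^ 2 - 2 * x ^ 2 = c} ∪
      {x : F | ¬ IsSquare (x + a) ∧ ¬ IsSquare x ∧ (x + a) ^ 2 - x ^ 2 = c} ∪
      {x : F | IsSquare (x + a) ∧ ¬ IsSquare x ∧ 2 * (x + a) ^ 2 - x ^ 2 = c} ∪
      {x : F | ¬ IsSquare (x + a) ∧ IsSquare x ∧ (x + a) ^ 2 - 2 * x ^ 2 = c}).ncard ≤ 4 := by
  have h2 : (2 : F) ≠ 0 := by
    intro h
    exact hneg ⟨1, by linear_combination -h⟩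
  set QQ := {x : F | IsSquare (x + a) ∧ IsSquare x ∧ 2 * (x + a) ^ 2 - 2 * x ^ 2 = c}
  set NN := {x : F | ¬ IsSquare (x + a) ∧ ¬ IsSquare x ∧ (x + a) ^ 2 - x ^ 2 = c}
  set QN := {x : F | IsSquare (x + a) ∧ ¬ IsSquare x ∧ 2 * (x + a) ^ 2 - x ^ 2 = c}
  set NQ := {x : F | ¬ IsSquare (x + a) ∧ IsSquare x ∧ (x + a) ^ 2 - 2 * x ^ 2 = c}
  have addQN : ∀ x ∈ QN, ∀ y ∈ QN, x ≠ y → x + y = -4 * a := by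
    rintro x ⟨-, -, hx⟩ y ⟨-, -, hy⟩ hxy
    apply mul_left_cancel₀ (sub_ne_zero.2 hxy)
    linear_combination hx - hy
  have addNQ : ∀ x ∈ NQ, ∀ y ∈ NQ, x ≠ y → x + y = 2 * a := by
    rintro x ⟨-, -, hx⟩ y ⟨-, -, hy⟩ hxy
    apply mul_left_cancel₀ (sub_ne_zero.2 hxy)
    linear_combination hy - hx
  have cardQQ : QQ.ncard ≤ 1 := by
    rw [Set.ncard_le_one]
    rintro x ⟨-, -, hx⟩ y ⟨-, -, hy⟩
    apply mul_left_cancel₀ (mul_ne_zero (mul_ne_zero h2 h2) ha)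
    linear_combination hx - hy
  have cardNN : NN.ncard ≤ 1 := by
    rw [Set.ncard_le_one]
    rintro x ⟨-, -, hx⟩ y ⟨-, -, hy⟩
    apply mul_left_cancel₀ (mul_ne_zero h2 ha)
    linear_combination hx - hy
  have cardQN : QN.ncard ≤ 2 := Set.ncard_le_two_of_add_eq _ addQN
  have cardNQ : NQ.ncard ≤ 2 := Set.ncard_le_two_of_add_eq _ addNQ
  have QQ_eq_empty : ∀ u v : F, u ≠ 0 → v ≠ 0 → IsSquare u → IsSquare v →
      2 * a ^ 2 - c = u → 2 * a ^ 2 + c = v → QQ = ∅ := by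
    intro u v hu0 hv0 hu hv hcu hcv
    rw [Set.eq_empty_iff_forall_notMem]
    rintro z ⟨hza, hz, hzc⟩
    refine mul_ne_zero hu0 hv0 ((hu.mul hv).eq_zero_of_isSquare_neg hneg ?_)
    have h : -(u * v) = (z + a) * z * (4 * a * (4 * a)) := by
      rw [← hcu, ← hcv, ← hzc]
      ring
    rw [h]
    exact (hza.mul hz).mul ⟨_, rfl⟩
  have ne_zero_of_not : ∀ {u : F}, ¬ IsSquare u → u ≠ 0 := by
    rintro u hu rfl
    exact hu .zero
  have QQ_of_QN : 1 < QN.ncard → QQ.ncard = 0 := by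
    intro h
    obtain ⟨x, hx, y, hy, hxy⟩ := (Set.one_lt_ncard).1 h
    have hadd := addQN x hx y hy hxy
    obtain ⟨-, hxN, hxc⟩ := hx
    obtain ⟨-, hyN, hyc⟩ := hy
    rw [QQ_eq_empty (x * y) ((x + 2 * a) * (x + 2 * a))
      (mul_ne_zero (ne_zero_of_not hxN) (ne_zero_of_not hyN)) ?_
      (FiniteField.isSquare_mul_of_not_isSquare hxN hyN) ⟨_, rfl⟩ ?_ ?_, Set.ncard_empty]
    · have h0 : x + 2 * a ≠ 0 := by
        intro h0
        apply hxy
        linear_combination 2 * h0 - hadd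
      exact mul_ne_zero h0 h0
    · linear_combination hxc - x * hadd
    · linear_combination -hxc
  have QQ_of_NQ : 1 < NQ.ncard → QQ.ncard = 0 := by
    intro h
    obtain ⟨x, hx, y, hy, hxy⟩ := (Set.one_lt_ncard).1 h
    have hadd := addNQ x hx y hy hxy
    obtain ⟨hxN, -, hxc⟩ := hx
    obtain ⟨hyN, -, hyc⟩ := hy
    rw [QQ_eq_empty ((x - a) * (x - a)) ((x + a) * (y + a)) ?_
      (mul_ne_zero (ne_zero_of_not hxN) (ne_zero_of_not hyN)) ⟨_, rfl⟩
      (FiniteField.isSquare_mul_of_not_isSquare hxN hyN) ?_ ?_, Set.ncard_empty]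
    · have h0 : x - a ≠ 0 := by
        intro h0
        apply hxy
        linear_combination 2 * h0 - hadd
      exact mul_ne_zero h0 h0
    · linear_combination hxc
    · linear_combination -hxc - (x + a) * hadd
  have NN_of_QN_of_NQ : 1 < QN.ncard → 1 < NQ.ncard → NN.ncard = 0 := by
    intro h h'
    obtain ⟨x, hx, y, hy, hxy⟩ := (Set.one_lt_ncard).1 h
    obtain ⟨s, hs, t, ht, hst⟩ := (Set.one_lt_ncard).1 h'
    have hadd := addQN x hx y hy hxy
    have hadd' := addNQ s hs t ht hst
    obtain ⟨hxQ, -, hxc⟩ := hx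
    obtain ⟨hyQ, -, -⟩ := hy
    obtain ⟨-, hsQ, hsc⟩ := hs
    obtain ⟨-, htQ, -⟩ := ht
    rw [Set.ncard_eq_zero, Set.eq_empty_iff_forall_notMem]
    rintro z ⟨hzaN, hzN, hzc⟩
    have hu : (x + a) * (y + a) = -(2 * a * (z + a)) := by
      linear_combination (x + a) * hadd - hxc + hzc
    have hv : s * t = 2 * a * z := by
      linear_combination s * hadd' + hsc - hzc
    have h2a : 2 * a ≠ 0 := mul_ne_zero h2 ha
    have hsq : IsSquare (2 * a * z * (2 * a * (z + a))) := by
      have h : 2 * a * z * (2 * a * (z + a)) = z * (z + a) * (2 * a * (2 * a)) := by ring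
      rw [h]
      exact (FiniteField.isSquare_mul_of_not_isSquare hzN hzaN).mul ⟨_, rfl⟩
    refine mul_ne_zero (mul_ne_zero h2a (ne_zero_of_not hzN))
      (mul_ne_zero h2a (ne_zero_of_not hzaN)) (hsq.eq_zero_of_isSquare_neg hneg ?_)
    rw [← mul_neg, ← hu, ← hv]
    exact (hsQ.mul htQ).mul (hxQ.mul hyQ)
  have h₁ := Set.ncard_union_le (QQ ∪ NN ∪ QN) NQ
  have h₂ := Set.ncard_union_le (QQ ∪ NN) QN
  have h₃ := Set.ncard_union_le QQ NN
  omega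

/-- Corollary 21 of the paper: for `p ≠ 3`, `q ≡ 3 (mod 4)`,
the differential uniformity of `F(x) = x^2 (1 + 3⁻¹ η(x))` is at most `4`. -/
theorem stmt_13 {F : Type*} [Field F] [Fintype F] [DecidableEq F]
    (hodd : Odd (Fintype.card F)) (h4 : Fintype.card F % 4 = 3)
    (h3 : (3 : F) ≠ 0) :
    ∀ a b : F, a ≠ 0 →
      {x : F | (x + a) ^ 2 * (1 + (3 : F)⁻¹ * ((quadraticChar F (x + a) : ℤ) : F))
          - x ^ 2 * (1 + (3 : F)⁻¹ * ((quadraticChar F x : ℤ) : F)) = b}.ncard ≤ 4 := by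
  intro a b ha
  have hneg : ¬ IsSquare (-1 : F) := fun h => FiniteField.isSquare_neg_one_iff.1 h h4
  have h2 : (2 : F) ≠ 0 := by
    intro h
    exact hneg ⟨1, by linear_combination -h⟩
  refine (Set.ncard_le_ncard ?_).trans
    (ncard_piecewise_sq_derivative_le_four hneg ha (3 * b / 2))
  intro x hx
  rw [Set.mem_ofPred_eq] at hx
  simp only [Set.mem_union, Set.mem_ofPred_eq]
  by_cases hxa : IsSquare (x + a) <;> by_cases hx0 : IsSquare x <;>
    simp only [hxa, hx0, not_true_eq_false, not_false_eq_true, true_and, false_and, false_or,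
      or_false, mul_one_add_quadraticChar_of_isSquare,
      mul_one_add_quadraticChar_of_not_isSquare] at hx ⊢ <;>
    rw [← hx] <;> field_simp <;> ring
end
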